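/- Let V be a set, n ≥ 1, and let c = (c₁, …, cₙ) ∈ Vⁿ be a tuple whose induced partition is non-crossing, with indices read modulo n. Suppose there exist v ∈ V and i, r with 2 ≤ r ≤ n such that c_i = v = c_{i+r} and c_{i+s} ≠ v for all s with 1 ≤ s ≤ r−1. Then there exists an element u ∈ V that occurs consecutively in c (its occurrence indices form a nonempty cyclic interval of ℤ/nℤ) and all of whose occurrences lie among the positions c_{i+1}, …, c_{i+r−1} (indices modulo n). -/

import Mathlib

/-- The partition of `Fin n` induced by a tuple `c : Fin n → V` (grouping `i` and `j`
exactly when `c i = c j`) is non-crossing: there are no indices `i < j < k < l` with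
`c i = c k`, `c j = c l` and `c i ≠ c j`. -/
def TupleNonCrossing {V : Type*} {n : ℕ} (c : Fin n → V) : Prop :=
  ¬ ∃ i j k l : Fin n, i < j ∧ j < k ∧ k < l ∧ c i = c k ∧ c j = c l ∧ c i ≠ c j

/-- A set `S` of indices in `Fin n` is a (nonempty) cyclic interval of `ℤ/nℤ`:
it consists of `m ≥ 1` consecutive residues `a, a+1, …, a+m-1` modulo `n`. -/
def IsCyclicInterval {n : ℕ} (S : Set (Fin n)) : Prop :=
  ∃ a m : ℕ, 0 < m ∧ S = {i : Fin n | ∃ s < m, (i : ℕ) = (a + s) % n}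

/-- If consecutive positions `0, …, n - 1` carry a non-crossing sequence `d` and the value `d 0`
reappears at `r` but not strictly between, then there is a nonempty interval of positions strictly
between `0` and `r` on which `d` is constant and outside which that constant does not occur. -/
theorem exists_isolated_constant_interval {V : Type*} {n r : ℕ} (d : ℕ → V)
    (hd : ∀ w x y z : ℕ, w < x → x < y → y < z → z < n → d w = d y → d x = d z → d w = d x)
    (hr2 : 2 ≤ r) (hrn : r ≤ n) (h0r : d 0 = d r)
    (hmid : ∀ s, 1 ≤ s → s < r → d s ≠ d 0) :
    ∃ p q : ℕ, 1 ≤ p ∧ p ≤ q ∧ q < r ∧ ∀ t < n, d t = d p ↔ p ≤ t ∧ t ≤ q := by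
  classical
  let IsClosedOfLength (L : ℕ) : Prop := ∃ p q : ℕ, q = p + L ∧ 1 ≤ p ∧ q < r ∧
    ∀ s, p ≤ s → s ≤ q → ∀ t < n, d t = d s → p ≤ t ∧ t ≤ q
  have hex : ∃ L, IsClosedOfLength L := by
    refine ⟨r - 2, 1, r - 1, by omega, le_rfl, by omega, fun s hs1 hs2 t ht hts => ?_⟩
    have hs := hmid s hs1 (by omega)
    have ht0 : t ≠ 0 := by rintro rfl; exact hs hts.symm
    have htr : t ≠ r := by rintro rfl; exact hs (hts.symm.trans h0r.symm)
    refine ⟨by omega, ?_⟩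
    by_contra hlt
    exact hs (hd 0 s r t (by omega) (by omega) (by omega) ht h0r hts.symm).symm
  obtain ⟨p, q, hq, hp1, hqr, hclosed⟩ := Nat.find_spec hex
  have hmin : ∀ p' q' : ℕ, p ≤ p' → p' ≤ q' → q' ≤ q → q' - p' < q - p →
      ¬ ∀ s, p' ≤ s → s ≤ q' → ∀ t < n, d t = d s → p' ≤ t ∧ t ≤ q' := by
    intro p' q' h1 h2 h3 h4 h
    exact Nat.find_min hex (m := q' - p') (by omega)
      ⟨p', q', by omega, by omega, by omega, h⟩
  have hconst : ∀ s, p ≤ s → s ≤ q → d s = d p := by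
    by_contra! hne
    let s := Nat.find hne
    obtain ⟨hps, hsq, hsp⟩ : p ≤ s ∧ s ≤ q ∧ d s ≠ d p := Nat.find_spec hne
    have hbefore : ∀ y, p ≤ y → y < s → d y = d p := by
      intro y hy hys
      by_contra hyp
      exact Nat.find_min hne hys ⟨hy, by omega, hyp⟩
    have hps' : p < s := lt_of_le_of_ne hps fun h => hsp (h ▸ rfl)
    by_cases hlater : ∃ t, s ≤ t ∧ t ≤ q ∧ d t = d p
    · let t := Nat.find hlater
      obtain ⟨hst, htq, htp⟩ : s ≤ t ∧ t ≤ q ∧ d t = d p := Nat.find_spec hlater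
      have hst' : s < t := lt_of_le_of_ne hst fun h => hsp (h ▸ htp)
      have hbetween : ∀ x, s ≤ x → x < t → d x ≠ d p := fun x hx hxt hxp =>
        Nat.find_min hlater hxt ⟨hx, by omega, hxp⟩
      refine hmin s (t - 1) hps (by omega) (by omega) (by omega) fun x hx hxt y hy hyx => ?_
      have hxp := hbetween x hx (by omega)
      obtain ⟨hpy, hyq⟩ := hclosed x (by omega) (by omega) y hy hyx
      constructor
      · by_contra! hlt
        exact hxp (hyx.symm.trans (hbefore y hpy hlt))
      · by_contra! hlt
        have hyt : y ≠ t := fun h => hxp (hyx.symm.trans (h ▸ htp))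
        exact hxp (hd p x t y (by omega) (by omega) (by omega) hy htp.symm hyx.symm).symm
    · push Not at hlater
      refine hmin s q hps hsq le_rfl (by omega) fun x hx hxq y hy hyx => ?_
      obtain ⟨hpy, hyq⟩ := hclosed x (by omega) hxq y hy hyx
      refine ⟨?_, hyq⟩
      by_contra! hlt
      exact hlater x hx hxq (hyx.symm.trans (hbefore y hpy hlt))
  exact ⟨p, q, hp1, by omega, hqr, fun t ht =>
    ⟨hclosed p le_rfl (by omega) t ht, fun h => hconst t h.1 h.2⟩⟩

/-- Being non-crossing is invariant under rotating the indices. -/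
theorem TupleNonCrossing.rotate {V : Type*} {n : ℕ} (hn : 1 ≤ n) {c : Fin n → V}
    (hc : TupleNonCrossing c) (i : ℕ) (d : ℕ → V)
    (hd : ∀ s, d s = c ⟨(i + s) % n, Nat.mod_lt (i + s) hn⟩)
    (w x y z : ℕ) (hwx : w < x) (hxy : x < y) (hyz : y < z) (hzn : z < n)
    (hwy : d w = d y) (hxz : d x = d z) : d w = d x := by
  have hlinear : ∀ a b e f : Fin n, a < b → b < e → e < f → c a = c e → c b = c f → c a = c b := by
    intro a b e f h1 h2 h3 h4 h5
    by_contra h6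
    exact hc ⟨a, b, e, f, h1, h2, h3, h4, h5, h6⟩
  have hi := Nat.mod_lt i hn
  have hlow : ∀ s, i % n + s < n → (i + s) % n = i % n + s := by
    intro s h
    rw [← Nat.mod_add_mod, Nat.mod_eq_of_lt h]
  have hhigh : ∀ s < n, ¬ i % n + s < n → (i + s) % n = i % n + s - n := by
    intro s hs h
    rw [← Nat.mod_add_mod, Nat.mod_eq_sub_mod (by omega), Nat.mod_eq_of_lt (by omega)]
  have hlt_low : ∀ s t, s < t → i % n + t < n → (i + s) % n < (i + t) % n := by
    intro s t hst ht
    rw [hlow s (by omega), hlow t ht]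
    omega
  have hlt_high : ∀ s t, s < t → t < n → ¬ i % n + s < n → (i + s) % n < (i + t) % n := by
    intro s t hst ht hs
    rw [hhigh s (by omega) hs, hhigh t ht (by omega)]
    omega
  have hlt_wrap : ∀ s t, s < n → i % n + t < n → ¬ i % n + s < n →
      (i + s) % n < (i + t) % n := by
    intro s t hsn ht hs
    rw [hhigh s hsn hs, hlow t ht]
    omega
  have hxn : x < n := by omega
  have hyn : y < n := by omega
  rw [hd, hd] at hwy hxz ⊢
  by_cases hz : i % n + z < n
  · exact hlinear _ _ _ _ (hlt_low w x hwx (by omega)) (hlt_low x y hxy (by omega))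
      (hlt_low y z hyz hz) hwy hxz
  by_cases hy : i % n + y < n
  · exact (hlinear _ _ _ _ (hlt_wrap z w hzn (by omega) hz) (hlt_low w x hwx (by omega))
      (hlt_low x y hxy hy) hxz.symm hwy).symm.trans hxz.symm
  by_cases hx : i % n + x < n
  · exact hwy.trans ((hlinear _ _ _ _ (hlt_high y z hyz hzn hy) (hlt_wrap z w hzn (by omega) hz)
      (hlt_low w x hwx hx) hwy.symm hxz.symm).trans hxz.symm)
  by_cases hw : i % n + w < n
  · exact hwy.trans (hlinear _ _ _ _ (hlt_high x y hxy hyn hx) (hlt_high y z hyz hzn hy)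
      (hlt_wrap z w hzn hw hz) hxz hwy.symm).symm
  · exact hlinear _ _ _ _ (hlt_high w x hwx hxn hw) (hlt_high x y hxy hyn hx)
      (hlt_high y z hyz hzn hy) hwy hxz

/-- Suppose the partition induced by `c ∈ Vⁿ` (`n ≥ 1`) is non-crossing, and (reading
indices modulo `n`) there are `v ∈ V` and `i, r` with `2 ≤ r ≤ n` such that
`c_i = v = c_{i+r}` while `c_{i+s} ≠ v` for all `1 ≤ s ≤ r-1`. Then some `u ∈ V`
occurs consecutively in `c` (its occurrence indices form a nonempty cyclic interval of
`ℤ/nℤ`) and all of its occurrences lie among the positions `i+1, …, i+r-1` (mod `n`). -/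
theorem exists_cyclically_consecutive_between {V : Type*} {n : ℕ} (hn : 1 ≤ n)
    (c : Fin n → V) (hc : TupleNonCrossing c) (v : V) (i r : ℕ)
    (hr2 : 2 ≤ r) (hrn : r ≤ n)
    (hvi : c ⟨i % n, Nat.mod_lt i hn⟩ = v)
    (hvir : c ⟨(i + r) % n, Nat.mod_lt (i + r) hn⟩ = v)
    (hmid : ∀ s : ℕ, 1 ≤ s → s ≤ r - 1 → c ⟨(i + s) % n, Nat.mod_lt (i + s) hn⟩ ≠ v) :
    ∃ u : V, (∃ k, c k = u) ∧ IsCyclicInterval {k : Fin n | c k = u} ∧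
      ∀ k : Fin n, c k = u → ∃ s : ℕ, 1 ≤ s ∧ s ≤ r - 1 ∧ (k : ℕ) = (i + s) % n := by
  let d : ℕ → V := fun s => c ⟨(i + s) % n, Nat.mod_lt (i + s) hn⟩
  have hd0 : d 0 = v := hvi
  have hsurj : ∀ k : Fin n, ∃ s < n, (k : ℕ) = (i + s) % n := by
    intro k
    refine ⟨(k + (n - i % n)) % n, Nat.mod_lt _ hn, ?_⟩
    have hi := Nat.mod_lt i hn
    rw [Nat.add_mod, Nat.mod_mod, ← Nat.add_mod_mod, Nat.mod_mod, Nat.add_mod_mod,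
      show i % n + (k + (n - i % n)) = k + n by omega, Nat.add_mod_right, Nat.mod_eq_of_lt k.2]
  have hck : ∀ (k : Fin n) (s : ℕ), (k : ℕ) = (i + s) % n → c k = d s := fun k s h =>
    congrArg c (Fin.ext h)
  obtain ⟨p, q, hp, hpq, hqr, hiff⟩ := exists_isolated_constant_interval d
    (hc.rotate hn i d fun _ => rfl) hr2 hrn (hd0.trans hvir.symm)
    fun s h1 h2 => hd0 ▸ hmid s h1 (by omega)
  refine ⟨d p, ⟨_, rfl⟩, ⟨i + p, q - p + 1, by omega, ?_⟩, fun k hk => ?_⟩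
  · ext k
    simp only [Set.mem_ofPred_eq]
    constructor
    · intro hk
      obtain ⟨s, hs, hks⟩ := hsurj k
      obtain ⟨h1, h2⟩ := (hiff s hs).1 ((hck k s hks).symm.trans hk)
      exact ⟨s - p, by omega, by rw [hks, show i + p + (s - p) = i + s by omega]⟩
    · rintro ⟨s, hs, hks⟩
      rw [hck k (p + s) (by rw [hks, add_assoc])]
      exact (hiff (p + s) (by omega)).2 ⟨by omega, by omega⟩
  · obtain ⟨s, hs, hks⟩ := hsurj k
    obtain ⟨h1, h2⟩ := (hiff s hs).1 ((hck k s hks).symm.trans hk)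
    exact ⟨s, by omega, by omega, hks⟩
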